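/- Let d_n be the number of packed words of length n and i_n the number of irreducible packed words of length n. Then for n ≥ 1, i_n = Σ (−1)^{k+1} d_{j₁}·d_{j₂}···d_{j_k}, where the sum ranges over all compositions (j₁,...,j_k) of n into positive parts (j₁ + ... + j_k = n, each j_l ≥ 1). -/

import Mathlib

/-- Words over the alphabet `X = {x_i : i ≥ 0}`, identified with lists of natural numbers. -/
abbrev Word : Type := List ℕ

/-- `IAlph w` is the set of indices of letters occurring in `w`. -/
def IAlph (w : Word) : Finset ℕ := w.toFinset

/-- `wsup w` is the supremum of `IAlph w` (0 for the empty word). -/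
def wsup (w : Word) : ℕ := w.foldr max 0

/-- The substitution `S_φ` replaces each letter `x_i` by `x_{φ i}`. -/
def subst (φ : ℕ → ℕ) (w : Word) : Word := w.map φ

/-- The packing substitution `φ_w`: it sends the `m`-th smallest nonzero letter of `w` to `m`,
and `0` to `0`. -/
def packMap (w : Word) (i : ℕ) : ℕ := (((IAlph w).erase 0).filter (fun j => j ≤ i)).card

/-- `pack w = S_{φ_w} w`. -/
def pack (w : Word) : Word := subst (packMap w) w

/-- A word is packed if `pack w = w`. -/
def IsPacked (w : Word) : Prop := pack w = w

/-- `T_t`: shift every nonzero letter by `t`, fixing `x_0`. -/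
def shiftW (t : ℕ) (w : Word) : Word := subst (fun n => if n = 0 then 0 else n + t) w

/-- Shifted concatenation `u * v = u · T_{sup u}(v)`. -/
def sc (u v : Word) : Word := u ++ shiftW (wsup u) v

/-- `w[I]`: the subword of `w` formed by the letters at the (1-indexed) positions in `I`,
taken in increasing order of position. -/
def subword (w : Word) (I : Finset ℕ) : Word :=
  ((List.range w.length).filter (fun j => decide (j + 1 ∈ I))).map (fun j => w.getD j 0)

/-- Quotient by a set of indices: `w / A = S_{φ_A} w` where `φ_A i = 0` if `i ∈ A`, else `i`. -/
def quotSet (w : Word) (A : Finset ℕ) : Word := subst (fun i => if i ∈ A then 0 else i) w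

/-- Quotient by a word: `w / u = w / IAlph u`. -/
def quotWord (w u : Word) : Word := quotSet w (IAlph u)

/-- A packed word is irreducible if it cannot be written as `u * v` with `u, v`
both nonempty packed words. -/
def IrredPacked (w : Word) : Prop :=
  IsPacked w ∧
    ¬∃ u v : Word, u ≠ [] ∧ v ≠ [] ∧ IsPacked u ∧ IsPacked v ∧ w = sc u v

/-- The number `d_n` of packed words of length `n`. -/
noncomputable def dWords (n : ℕ) : ℕ := Nat.card {w : Word // IsPacked w ∧ w.length = n}

/-- The number `i_n` of irreducible packed words of length `n`. -/
noncomputable def iWords (n : ℕ) : ℕ := Nat.card {w : Word // IrredPacked w ∧ w.length = n}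

theorem isPacked_iff {w : Word} : IsPacked w ↔ ∀ x ∈ w, ∀ y, 1 ≤ y → y ≤ x → y ∈ w := by
  have key : ∀ x, packMap w x = x ↔ ∀ y, 1 ≤ y → y ≤ x → y ∈ w := by
    intro x
    have hsub : ((IAlph w).erase 0).filter (fun j => j ≤ x) ⊆ Finset.Icc 1 x := by
      intro y hy
      simp only [Finset.mem_filter, Finset.mem_erase, Finset.mem_Icc] at hy ⊢
      omega
    constructor
    · intro h y hy1 hy2
      have heq := Finset.eq_of_subset_of_card_le hsub (by
        rw [Nat.card_Icc, Nat.add_sub_cancel]; exact h.ge)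
      have hy : y ∈ Finset.Icc 1 x := Finset.mem_Icc.2 ⟨hy1, hy2⟩
      rw [← heq] at hy
      simp only [IAlph, Finset.mem_filter, Finset.mem_erase, List.mem_toFinset] at hy
      exact hy.1.2
    · intro h
      have heq : ((IAlph w).erase 0).filter (fun j => j ≤ x) = Finset.Icc 1 x := by
        refine hsub.antisymm fun y hy => ?_
        rw [Finset.mem_Icc] at hy
        simp only [IAlph, Finset.mem_filter, Finset.mem_erase, List.mem_toFinset]
        exact ⟨⟨by omega, h y hy.1 hy.2⟩, hy.2⟩
      rw [packMap, heq, Nat.card_Icc, Nat.add_sub_cancel]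
  have hmap : IsPacked w ↔ ∀ x ∈ w, packMap w x = x := by
    rw [IsPacked, pack, subst]
    conv_lhs => rhs; rw [← List.map_id w]
    exact List.map_inj_left
  rw [hmap]
  exact forall₂_congr fun x _ => key x

theorem isPacked_nil : IsPacked [] := rfl

theorem IsPacked.le_length {w : Word} (hw : IsPacked w) {x : ℕ} (hx : x ∈ w) : x ≤ w.length := by
  have hsub : Finset.Icc 1 x ⊆ w.toFinset := fun y hy => by
    rw [Finset.mem_Icc] at hy
    exact List.mem_toFinset.2 (isPacked_iff.1 hw x hx y hy.1 hy.2)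
  have h := (Finset.card_le_card hsub).trans w.toFinset_card_le
  rwa [Nat.card_Icc, Nat.add_sub_cancel] at h

theorem le_wsup {w : Word} {x : ℕ} (hx : x ∈ w) : x ≤ wsup w := by
  induction w with
  | nil => simp at hx
  | cons a w ih =>
    simp only [wsup, List.foldr_cons] at ih ⊢
    rcases List.mem_cons.1 hx with rfl | h
    · exact le_max_left _ _
    · exact (ih h).trans (le_max_right _ _)

theorem wsup_mem {w : Word} (h : wsup w ≠ 0) : wsup w ∈ w := by
  induction w with
  | nil => simp [wsup] at h
  | cons a w ih =>
    simp only [wsup, List.foldr_cons] at ih h ⊢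
    rcases le_total a (List.foldr max 0 w) with hle | hle
    · rw [max_eq_right hle] at h ⊢
      exact List.mem_cons_of_mem _ (ih h)
    · rw [max_eq_left hle]
      exact List.mem_cons_self

theorem mem_shiftW {t y : ℕ} {w : Word} :
    y ∈ shiftW t w ↔ (y = 0 ∧ 0 ∈ w) ∨ ∃ x ∈ w, x ≠ 0 ∧ x + t = y := by
  simp only [shiftW, subst, List.mem_map]
  constructor
  · rintro ⟨x, hx, rfl⟩
    rcases eq_or_ne x 0 with rfl | h
    · exact Or.inl ⟨by simp, hx⟩
    · exact Or.inr ⟨x, hx, h, by simp [h]⟩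
  · rintro (⟨rfl, h⟩ | ⟨x, hx, h, rfl⟩)
    · exact ⟨0, h, by simp⟩
    · exact ⟨x, hx, by simp [h]⟩

theorem length_sc (u v : Word) : (sc u v).length = u.length + v.length := by
  simp [sc, shiftW, subst]

theorem sc_nil (u : Word) : sc u [] = u := by
  simp [sc, shiftW, subst]

theorem shiftW_append (t : ℕ) (u v : Word) : shiftW t (u ++ v) = shiftW t u ++ shiftW t v :=
  List.map_append

theorem shiftW_shiftW (s t : ℕ) (w : Word) : shiftW s (shiftW t w) = shiftW (s + t) w := by
  simp only [shiftW, subst, List.map_map]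
  refine List.map_congr_left fun x _ => ?_
  simp only [Function.comp_apply]
  split_ifs <;> omega

theorem shiftW_injective (t : ℕ) : Function.Injective (shiftW t) := by
  refine List.map_injective_iff.2 fun x y h => ?_
  split_ifs at h <;> omega

theorem wsup_sc (u v : Word) : wsup (sc u v) = wsup u + wsup v := by
  apply le_antisymm
  · rcases eq_or_ne (wsup (sc u v)) 0 with h | h
    · omega
    · rcases List.mem_append.1 (wsup_mem h) with hu | hv
      · exact (le_wsup hu).trans (Nat.le_add_right _ _)
      · rcases mem_shiftW.1 hv with ⟨h0, -⟩ | ⟨x, hx, -, hxy⟩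
        · exact absurd h0 h
        · have hle := le_wsup hx
          change x + wsup u = wsup (sc u v) at hxy
          omega
  · rcases eq_or_ne (wsup v) 0 with h | h
    · rcases eq_or_ne (wsup u) 0 with h' | h'
      · omega
      · rw [h, Nat.add_zero]
        exact le_wsup (List.mem_append_left _ (wsup_mem h'))
    · rw [Nat.add_comm]
      exact le_wsup (List.mem_append_right _ (mem_shiftW.2 (Or.inr ⟨_, wsup_mem h, h, rfl⟩)))

theorem sc_assoc (u v w : Word) : sc (sc u v) w = sc u (sc v w) := by
  rw [sc, wsup_sc, sc, sc, sc, shiftW_append, shiftW_shiftW, List.append_assoc]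

theorem IsPacked.sc {u v : Word} (hu : IsPacked u) (hv : IsPacked v) : IsPacked (sc u v) := by
  rw [isPacked_iff] at *
  intro x hx y hy hyx
  rcases List.mem_append.1 hx with hx | hx
  · exact List.mem_append_left _ (hu x hx y hy hyx)
  · rcases mem_shiftW.1 hx with ⟨rfl, -⟩ | ⟨z, hz, hz0, rfl⟩
    · omega
    · rcases le_or_gt y (wsup u) with h | h
      · exact List.mem_append_left _ (hu _ (wsup_mem (by omega)) y hy h)
      · exact List.mem_append_right _ (mem_shiftW.2 (Or.inr
          ⟨y - wsup u, hv z hz _ (by omega) (by omega), by omega, by omega⟩))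

theorem IsPacked.of_sc_right {u v : Word} (h : IsPacked (_root_.sc u v)) : IsPacked v := by
  rw [isPacked_iff] at *
  intro x hx y hy hyx
  have hxs : x + wsup u ∈ _root_.sc u v :=
    List.mem_append_right _ (mem_shiftW.2 (Or.inr ⟨x, hx, by omega, rfl⟩))
  rcases List.mem_append.1 (h _ hxs (y + wsup u) (by omega) (by omega)) with hm | hm
  · have := le_wsup hm
    omega
  · rcases mem_shiftW.1 hm with ⟨h0, -⟩ | ⟨z, hz, -, hzy⟩
    · omega
    · obtain rfl : z = y := by omega
      exact hz

theorem exists_irredPacked_sc {w : Word} (hw : IsPacked w) (hne : w ≠ []) :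
    ∃ u v : Word, IrredPacked u ∧ u ≠ [] ∧ IsPacked v ∧ w = sc u v := by
  by_cases hirr : IrredPacked w
  · exact ⟨w, [], hirr, hne, isPacked_nil, (sc_nil w).symm⟩
  · obtain ⟨u, v, hu, hv, hpu, hpv, rfl⟩ := not_not.1 fun h => hirr ⟨hw, h⟩
    have hlt : u.length < (sc u v).length := by
      have := List.length_pos_iff.2 hv
      rw [length_sc]
      omega
    obtain ⟨a, b, ha, hane, hb, rfl⟩ := exists_irredPacked_sc hpu hu
    exact ⟨a, sc b v, ha, hane, hb.sc hpv, sc_assoc a b v⟩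
termination_by w.length

theorem eq_of_append_eq_sc {u v t s : Word} (hu : IsPacked u) (hne : u ≠ [])
    (hirr : IrredPacked (u ++ t)) (h : (u ++ t) ++ s = sc u v) : t = [] := by
  by_contra ht
  rw [sc, List.append_assoc] at h
  obtain ⟨a, b, -, rfl, -⟩ := List.map_eq_append_iff.1 (List.append_cancel_left h).symm
  exact hirr.2 ⟨u, a, hne, fun ha => ht (by rw [ha]; rfl), hu, IsPacked.of_sc_right (u := u) hirr.1,
    rfl⟩

theorem sc_inj_of_irredPacked {u v u' v' : Word} (hu : IrredPacked u) (hne : u ≠ [])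
    (hu' : IrredPacked u') (hne' : u' ≠ []) (h : sc u v = sc u' v') : u = u' ∧ v = v' := by
  have huu : u = u' := by
    rcases List.append_eq_append_iff.1 h with ⟨t, rfl, -⟩ | ⟨t, rfl, -⟩
    · rw [eq_of_append_eq_sc hu.1 hne hu' h.symm, List.append_nil]
    · rw [eq_of_append_eq_sc hu'.1 hne' hu h, List.append_nil]
  subst huu
  exact ⟨rfl, shiftW_injective _ (List.append_cancel_left h)⟩

instance finite_packed (n : ℕ) : Finite {w : Word // IsPacked w ∧ w.length = n} := by
  refine Set.Finite.subset ((List.finite_length_eq (Fin (n + 1)) n).image (List.map Fin.val)) ?_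
  rintro w ⟨hw, rfl⟩
  refine ⟨w.pmap (fun x hx => ⟨x, Nat.lt_succ_of_le hx⟩) fun x hx => hw.le_length hx, by simp, ?_⟩
  simp [List.map_pmap]

instance finite_irredPacked (n : ℕ) :
    Finite {w : Word // (IrredPacked w ∧ w ≠ []) ∧ w.length = n} :=
  Finite.of_injective
    (fun w => (⟨w.1, w.2.1.1.1, w.2.2⟩ : {w : Word // IsPacked w ∧ w.length = n}))
    fun _ _ h => Subtype.ext (congrArg (fun w => w.1) h)

theorem dWords_zero : dWords 0 = 1 := by
  rw [dWords, Nat.card_eq_one_iff_unique]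
  exact ⟨⟨fun a b => Subtype.ext ((List.length_eq_zero_iff.1 a.2.2).trans
    (List.length_eq_zero_iff.1 b.2.2).symm)⟩, ⟨⟨[], isPacked_nil, rfl⟩⟩⟩

/-- The number of nonempty irreducible packed words of length `n`. -/
noncomputable def nonemptyIrredWords (n : ℕ) : ℕ :=
  Nat.card {w : Word // (IrredPacked w ∧ w ≠ []) ∧ w.length = n}

theorem nonemptyIrredWords_zero : nonemptyIrredWords 0 = 0 := by
  rw [nonemptyIrredWords, Nat.card_eq_zero]
  exact Or.inl ⟨fun w => w.2.1.2 (List.length_eq_zero_iff.1 w.2.2)⟩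

theorem nonemptyIrredWords_eq_iWords {n : ℕ} (hn : 1 ≤ n) : nonemptyIrredWords n = iWords n := by
  refine Nat.card_congr (Equiv.subtypeEquivRight fun w => ⟨fun h => ⟨h.1.1, h.2⟩, fun h => ?_⟩)
  refine ⟨⟨h.1, ?_⟩, h.2⟩
  rintro rfl
  simp at h
  omega

theorem dWords_eq_sum {n : ℕ} (hn : 1 ≤ n) :
    dWords n = ∑ p ∈ Finset.HasAntidiagonal.antidiagonal n, nonemptyIrredWords p.1 * dWords p.2 := by
  let f : (Σ p : Finset.HasAntidiagonal.antidiagonal n,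
      {w : Word // (IrredPacked w ∧ w ≠ []) ∧ w.length = p.1.1} ×
        {w : Word // IsPacked w ∧ w.length = p.1.2}) → {w : Word // IsPacked w ∧ w.length = n} :=
    fun x => ⟨sc x.2.1.1 x.2.2.1, x.2.1.2.1.1.1.sc x.2.2.2.1, by
      rw [length_sc, x.2.1.2.2, x.2.2.2.2]
      exact Finset.HasAntidiagonal.mem_antidiagonal.1 x.1.2⟩
  have hf : Function.Bijective f := by
    constructor
    · rintro ⟨⟨⟨i, j⟩, hp⟩, ⟨u, ⟨hu, hne⟩, hl⟩, ⟨v, hv, hl'⟩⟩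
        ⟨⟨⟨i', j'⟩, hp'⟩, ⟨u', ⟨hu', hne'⟩, hm⟩, ⟨v', hv', hm'⟩⟩ h
      obtain ⟨rfl, rfl⟩ := sc_inj_of_irredPacked hu hne hu' hne' (congrArg Subtype.val h)
      dsimp only at hl hl' hm hm'
      subst hl hl' hm hm'
      rfl
    · rintro ⟨w, hw, rfl⟩
      obtain ⟨u, v, hu, hne, hv, rfl⟩ :=
        exists_irredPacked_sc hw (List.length_pos_iff.1 hn)
      exact ⟨⟨⟨(u.length, v.length), Finset.HasAntidiagonal.mem_antidiagonal.2 (length_sc u v).symm⟩,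
        ⟨u, ⟨hu, hne⟩, rfl⟩, ⟨v, hv, rfl⟩⟩, rfl⟩
  rw [dWords, ← Nat.card_congr (Equiv.ofBijective f hf), Nat.card_sigma]
  simp only [Nat.card_prod]
  exact Finset.sum_coe_sort (Finset.HasAntidiagonal.antidiagonal n)
    fun p => nonemptyIrredWords p.1 * dWords p.2

section Compositions

variable {R : Type*} [CommRing R]

/-- Sum over the compositions of `n` of the products of `a` over the blocks. -/
def compositionSum (a : ℕ → R) (n : ℕ) : R := ∑ c : Composition n, (c.blocks.map a).prod

theorem compositionSum_zero (a : ℕ → R) : compositionSum a 0 = 1 := by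
  have h (c : Composition 0) : (c.blocks.map a).prod = 1 := by
    rw [c.blocks_eq_nil.2 rfl, List.map_nil, List.prod_nil]
  simp [compositionSum, h, composition_card]

theorem compositionSum_succ (a : ℕ → R) (n : ℕ) :
    compositionSum a (n + 1)
      = ∑ p ∈ Finset.HasAntidiagonal.antidiagonal n, a (p.1 + 1) * compositionSum a p.2 := by
  let f : (Σ p : Finset.HasAntidiagonal.antidiagonal n, Composition p.1.2) → Composition (n + 1) :=
    fun x => ⟨(x.1.1.1 + 1) :: x.2.blocks, by
      intro i hi
      rcases List.mem_cons.1 hi with rfl | hi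
      · exact Nat.succ_pos _
      · exact x.2.blocks_pos hi, by
      have := Finset.HasAntidiagonal.mem_antidiagonal.1 x.1.2
      rw [List.sum_cons, x.2.blocks_sum]
      omega⟩
  have hf : Function.Bijective f := by
    constructor
    · rintro ⟨⟨⟨i, j⟩, hp⟩, c⟩ ⟨⟨⟨i', j'⟩, hp'⟩, c'⟩ h
      have hb := congrArg Composition.blocks h
      simp only [f, List.cons.injEq] at hb
      obtain rfl : i = i' := by omega
      rw [Finset.HasAntidiagonal.mem_antidiagonal] at hp hp'
      obtain rfl : j = j' := by dsimp only at hp hp'; omega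
      obtain rfl : c = c' := Composition.ext hb.2
      rfl
    · rintro ⟨l, hpos, hsum⟩
      cases l with
      | nil => simp at hsum
      | cons b l =>
        have hb : 0 < b := hpos List.mem_cons_self
        rw [List.sum_cons] at hsum
        refine ⟨⟨⟨(b - 1, l.sum), Finset.HasAntidiagonal.mem_antidiagonal.2 (by omega)⟩,
          ⟨l, fun hi => hpos (List.mem_cons_of_mem _ hi), rfl⟩⟩, ?_⟩
        apply Composition.ext
        simp only [f]
        rw [Nat.sub_add_cancel hb]
  rw [compositionSum, ← Function.Bijective.sum_comp hf, Fintype.sum_sigma,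
    ← Finset.sum_coe_sort (Finset.HasAntidiagonal.antidiagonal n)]
  refine Finset.sum_congr rfl fun p _ => ?_
  simp only [f, List.map_cons, List.prod_cons]
  rw [compositionSum, Finset.mul_sum]

theorem mk_mul_mk_compositionSum (a : ℕ → R) (h0 : a 0 = 1) :
    PowerSeries.mk a * PowerSeries.mk (compositionSum fun j => -a j) = 1 := by
  ext n
  rw [PowerSeries.coeff_mul]
  simp only [PowerSeries.coeff_mk, PowerSeries.coeff_one]
  cases n with
  | zero => simp [h0, compositionSum_zero]
  | succ n =>
    rw [Finset.Nat.sum_antidiagonal_succ, compositionSum_succ, h0]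
    simp

end Compositions

theorem mk_dWords_eq :
    PowerSeries.mk (fun n => (dWords n : ℤ))
      = 1 + PowerSeries.mk (fun n => (nonemptyIrredWords n : ℤ))
        * PowerSeries.mk (fun n => (dWords n : ℤ)) := by
  ext n
  rw [map_add, PowerSeries.coeff_mul]
  simp only [PowerSeries.coeff_mk, PowerSeries.coeff_one]
  rcases Nat.eq_zero_or_pos n with rfl | hn
  · simp [dWords_zero, nonemptyIrredWords_zero]
  · rw [if_neg hn.ne', zero_add, dWords_eq_sum hn]
    push_cast
    rfl

theorem prod_map_neg_eq (a : ℕ → ℤ) (l : List ℕ) :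
    (l.map fun j => -a j).prod = (-1) ^ l.length * (l.map a).prod := by
  induction l with
  | nil => simp
  | cons b l ih =>
    simp only [List.map_cons, List.prod_cons, List.length_cons, ih]
    ring

/-- For `n ≥ 1`,
`i_n = Σ (−1)^{k+1} d_{j₁}⋯d_{j_k}`, the sum over all compositions `(j₁,…,j_k)` of `n`
into positive parts. -/
theorem irreducible_count (n : ℕ) (hn : 1 ≤ n) :
    (iWords n : ℤ)
      = ∑ c : Composition n,
          (-1 : ℤ) ^ (c.length + 1) * (c.blocks.map fun j => (dWords j : ℤ)).prod := by
  have hinv := mk_mul_mk_compositionSum (fun n => (dWords n : ℤ)) (by simp [dWords_zero])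
  have hI : PowerSeries.mk (fun n => (nonemptyIrredWords n : ℤ))
      = 1 - PowerSeries.mk (compositionSum fun j => -(dWords j : ℤ)) := by
    linear_combination
      -(PowerSeries.mk (compositionSum fun j => -(dWords j : ℤ))) * mk_dWords_eq
        + (PowerSeries.mk (fun n => (nonemptyIrredWords n : ℤ)) - 1) * (-hinv)
  have hcoeff := congrArg (PowerSeries.coeff n) hI
  rw [map_sub, PowerSeries.coeff_one, if_neg (by omega), zero_sub] at hcoeff
  simp only [PowerSeries.coeff_mk] at hcoeff
  rw [← nonemptyIrredWords_eq_iWords hn, hcoeff, compositionSum, ← Finset.sum_neg_distrib]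
  refine Finset.sum_congr rfl fun c _ => ?_
  rw [prod_map_neg_eq, Composition.blocks_length]
  ring
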